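/- For the map F_λ with λ ∈ (1/2,1), let φ : (0,1] → ℝ be a Hölder potential with lim_{x→0} φ(x) = a. Then for every α ≠ a one has dim_H(J_{φ,1}(α)) ≤ −log 4 / log(λ(1−λ)) < 1. In particular, since dim_H(J_{φ,1}(a)) = 1, the Birkhoff spectrum b_{φ,1}(α) := dim_H(J_{φ,1}(α)) is discontinuous at α = a. -/

import Mathlib

open Set Filter MeasureTheory Topology

noncomputable section

/-- The Birkhoff sum `S_n φ (x) = ∑_{i<n} φ(Tⁱ x)`. -/
def birk (T φ : ℝ → ℝ) (n : ℕ) (x : ℝ) : ℝ :=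
  ∑ i ∈ Finset.range n, φ (T^[i] x)

/-- The Markov partition of `(0,1]` for the map `F_λ`: `XF l 0 = (λ, 1)` is the paper's `X_1`
and `XF l n = (λ^{n+1}, λ^n)` is the paper's `X_{n+1}`. -/
def XF (l : ℝ) (n : ℕ) : Set ℝ := Set.Ioo (l ^ (n + 1)) (l ^ n)

-- The map `F_λ`: `x ↦ (x-λ)/(1-λ)` on `X_1 = (λ,1)` and
-- `x ↦ (x-λⁿ)/(λ(1-λ))` on `X_n = (λⁿ, λ^{n-1})` for `n ≥ 2`.
open scoped Classical in
def Fmap (l : ℝ) (x : ℝ) : ℝ :=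
  if x ∈ Set.Ioo l 1 then (x - l) / (1 - l)
  else if h : ∃ n : ℕ, x ∈ Set.Ioo (l ^ (n + 2)) (l ^ (n + 1)) then
    (x - l ^ (Nat.find h + 2)) / (l * (1 - l))
  else 0

/-- The absolute value of the derivative of `F_λ`: `1/(1-λ)` on `X_1` and
`1/(λ(1-λ))` on `X_n`, `n ≥ 2`. -/
def Fabsd (l : ℝ) (x : ℝ) : ℝ :=
  if x ∈ Set.Ioo l 1 then 1 / (1 - l) else 1 / (l * (1 - l))

/-- The domain `⋃ n, X_n` of `F_λ`. -/
def FdomainSet (l : ℝ) : Set ℝ := ⋃ n, XF l n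

/-- The repeller `X^∞` of `F_λ`: points whose whole forward orbit is defined. -/
def Frepeller (l : ℝ) : Set ℝ := {x | ∀ n : ℕ, (Fmap l)^[n] x ∈ FdomainSet l}

/-- The recurrent set `X_R` of `F_λ`. -/
def FrecSet (l : ℝ) : Set ℝ :=
  {x ∈ Frepeller l | ∃ m : ℕ, ∀ N : ℕ, ∃ n ≥ N, (Fmap l)^[n] x ∈ XF l m}

/-- The escaping set `Ω_λ` of points converging to `0` under iteration of `F_λ`. -/
def Fescape (l : ℝ) : Set ℝ :=
  {x ∈ Frepeller l | Filter.Tendsto (fun n : ℕ => (Fmap l)^[n] x) Filter.atTop (nhds 0)}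

/-- The level set `J_{φ,ψ}(α)` for quotients of Birkhoff averages of `F_λ`. -/
def FJset (l : ℝ) (φ ψ : ℝ → ℝ) (α : ℝ) : Set ℝ :=
  {x ∈ Frepeller l |
    Filter.Tendsto (fun n => birk (Fmap l) φ n x / birk (Fmap l) ψ n x)
      Filter.atTop (nhds α)}

/-- The restricted level set `J_{R,φ,ψ}(α) = J_{φ,ψ}(α) ∩ X_R`. -/
def FJR (l : ℝ) (φ ψ : ℝ → ℝ) (α : ℝ) : Set ℝ := FJset l φ ψ α ∩ FrecSet l

/-- The set of values of limits of quotients of Birkhoff averages on the repeller of `F_λ`. -/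
def FlimitSet (l : ℝ) (φ ψ : ℝ → ℝ) : Set ℝ :=
  {α | ∃ x ∈ Frepeller l,
    Filter.Tendsto (fun n => birk (Fmap l) φ n x / birk (Fmap l) ψ n x)
      Filter.atTop (nhds α)}

/-- The Birkhoff level set `J_{φ,1}(α) = {x : lim_n S_nφ(x)/n = α}`. -/
def FJB (l : ℝ) (φ : ℝ → ℝ) (α : ℝ) : Set ℝ :=
  {x ∈ Frepeller l |
    Filter.Tendsto (fun n => birk (Fmap l) φ n x / n) Filter.atTop (nhds α)}

/-- The set of Birkhoff averages attained as limits on the repeller of `F_λ`. -/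
def FlimB (l : ℝ) (φ : ℝ → ℝ) : Set ℝ :=
  {α | ∃ x ∈ Frepeller l,
    Filter.Tendsto (fun n => birk (Fmap l) φ n x / n) Filter.atTop (nhds α)}

/-- The Lyapunov level set
`J(α) = {x ∈ X^∞ : lim_n (1/n) log|(F_λⁿ)'(x)| = α}`. -/
def FJL (l : ℝ) (α : ℝ) : Set ℝ :=
  {x ∈ Frepeller l |
    Filter.Tendsto (fun n => birk (Fmap l) (fun y => Real.log (Fabsd l y)) n x / n)
      Filter.atTop (nhds α)}

/-- `φ : (0,1] → ℝ` is a Hölder potential. -/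
def HolderPotential (φ : ℝ → ℝ) : Prop :=
  ∃ C r : NNReal, 0 < r ∧ r ≤ 1 ∧ HolderOnWith C r φ (Set.Ioc 0 1)

/-- `F_λ`-invariant Borel probability measures supported on the repeller. -/
def FInvMeasure (l : ℝ) (μ : Measure ℝ) : Prop :=
  IsProbabilityMeasure μ ∧ μ (Frepeller l) = 1 ∧
    ∀ A : Set ℝ, MeasurableSet A → μ (Fmap l ⁻¹' A) = μ A

/-- A finite measurable partition of `ℝ`, with parts `P 0, …, P (k-1)`. -/
def IsFinPart (k : ℕ) (P : ℕ → Set ℝ) : Prop :=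
  (∀ i, MeasurableSet (P i)) ∧ (⋃ i ∈ Finset.range k, P i) = Set.univ ∧
    ∀ i j, i ≠ j → Disjoint (P i) (P j)

/-- The entropy `H_μ(⋁_{i<n} T^{-i} P)` of the `n`-th dynamical refinement of `P`. -/
def dynEnt (T : ℝ → ℝ) (μ : Measure ℝ) (k : ℕ) (P : ℕ → Set ℝ) (n : ℕ) : ℝ :=
  ∑ f : Fin n → Fin k,
    Real.negMulLog (μ (⋂ i : Fin n, T^[(i : ℕ)] ⁻¹' P (f i))).toReal

/-- Measure-theoretic (Kolmogorov–Sinai) entropy `h(μ)`. -/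
def entropy (T : ℝ → ℝ) (μ : Measure ℝ) : ℝ :=
  sSup {h | ∃ k : ℕ, ∃ P : ℕ → Set ℝ, IsFinPart k P ∧
    h = Filter.limsup (fun n => dynEnt T μ k P n / n) Filter.atTop}

/-- The Lyapunov exponent `λ_{F_λ}(μ) = ∫ log|F_λ'| dμ`. -/
def FlyapExp (l : ℝ) (μ : Measure ℝ) : ℝ := ∫ x, Real.log (Fabsd l x) ∂μ

/-- The one-sided shift on sequences. -/
def shiftMap (x : ℕ → ℕ) : ℕ → ℕ := fun i => x (i + 1)

/-- The shift space determined by a transition matrix `t` over the alphabet `ℕ`. -/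
def shiftSpace (t : ℕ → ℕ → Prop) : Set (ℕ → ℕ) := {x | ∀ i, t (x i) (x (i + 1))}

/-- Topological mixing of a countable Markov shift relative to a set `A` of symbols. -/
def TopMixingOn (t : ℕ → ℕ → Prop) (A : Set ℕ) : Prop :=
  ∀ a ∈ A, ∀ b ∈ A, ∃ N : ℕ, ∀ n ≥ N, n ≥ 1 → ∃ x ∈ shiftSpace t, x 0 = a ∧ x n = b

/-- A function on the shift space is locally Hölder: `var_n(g) ≤ C γⁿ` for all `n ≥ 1`. -/
def LocallyHolderOn (t : ℕ → ℕ → Prop) (g : (ℕ → ℕ) → ℝ) : Prop :=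
  ∃ C > (0 : ℝ), ∃ γ ∈ Set.Ioo (0 : ℝ) 1, ∀ n : ℕ, 1 ≤ n →
    ∀ x ∈ shiftSpace t, ∀ y ∈ shiftSpace t,
      (∀ i < n, x i = y i) → |g x - g y| ≤ C * γ ^ n

/-- A topologically mixing countable Markov coding `emb : Σ → X^∞` for `F_λ`. -/
def FCoding (l : ℝ) (t : ℕ → ℕ → Prop) (emb : (ℕ → ℕ) → ℝ) : Prop :=
  TopMixingOn t Set.univ ∧
  ContinuousOn emb (shiftSpace t) ∧
  Set.InjOn emb (shiftSpace t) ∧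
  emb '' shiftSpace t = Frepeller l ∧
  (∀ x ∈ shiftSpace t, Fmap l (emb x) = emb (shiftMap x)) ∧
  (∀ x ∈ shiftSpace t, emb x ∈ XF l (x 0))

open scoped ENNReal NNReal

/-- The size-`r` Hausdorff pre-measure in dimension `t`: only covers by sets of diameter at
most `r` are allowed. -/
def hausdorffPre (t : ℝ) (r : ℝ≥0∞) : OuterMeasure ℝ :=
  OuterMeasure.mkMetric'.pre (fun s : Set ℝ => Metric.ediam s ^ t) r

lemma hausdorffPre_anti (t : ℝ) {r r' : ℝ≥0∞} (h : r ≤ r') (s : Set ℝ) :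
    hausdorffPre t r' s ≤ hausdorffPre t r s :=
  OuterMeasure.mkMetric'.mono_pre _ h s

lemma hausdorffPre_image_le {t : ℝ} (ht : 0 ≤ t) {K : ℝ≥0} (hK : K ≠ 0) {g : ℝ → ℝ}
    (hg : LipschitzWith K g) {r r' : ℝ≥0∞} (hr : K * r ≤ r') (s : Set ℝ) :
    hausdorffPre t r' (g '' s) ≤ (K : ℝ≥0∞) ^ t * hausdorffPre t r s := by
  have hK' : (K : ℝ≥0∞) ≠ 0 := by simpa using hK
  have hc0 : (K : ℝ≥0∞) ^ t ≠ 0 := (ENNReal.rpow_pos (pos_iff_ne_zero.2 hK') (by simp)).ne'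
  have hct : (K : ℝ≥0∞) ^ t ≠ ∞ := ENNReal.rpow_ne_top_of_nonneg ht (by simp)
  have key : ((K : ℝ≥0∞) ^ t)⁻¹ • OuterMeasure.comap g (hausdorffPre t r')
      ≤ hausdorffPre t r := by
    refine OuterMeasure.mkMetric'.le_pre.2 fun u hu => ?_
    have hd : Metric.ediam (g '' u) ≤ K * Metric.ediam u := hg.ediam_image_le u
    have h1 : hausdorffPre t r' (g '' u) ≤ (K : ℝ≥0∞) ^ t * Metric.ediam u ^ t := by
      refine (OuterMeasure.mkMetric'.pre_le (hd.trans ((by gcongr : _ ≤ K * r).trans hr))).trans ?_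
      rw [← ENNReal.mul_rpow_of_nonneg _ _ ht]
      exact ENNReal.rpow_le_rpow hd ht
    rw [_root_.smul_apply, OuterMeasure.comap_apply, smul_eq_mul]
    calc _ ≤ ((K : ℝ≥0∞) ^ t)⁻¹ * ((K : ℝ≥0∞) ^ t * Metric.ediam u ^ t) := by gcongr
      _ = _ := by rw [← mul_assoc, ENNReal.inv_mul_cancel hc0 hct, one_mul]
  have h2 := key s
  rw [_root_.smul_apply, OuterMeasure.comap_apply, smul_eq_mul] at h2
  calc _ = (K : ℝ≥0∞) ^ t * (((K : ℝ≥0∞) ^ t)⁻¹ * hausdorffPre t r' (g '' s)) := by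
        rw [← mul_assoc, ENNReal.mul_inv_cancel hc0 hct, one_mul]
    _ ≤ _ := by gcongr

lemma hausdorffMeasure_eq_zero_of_hausdorffPre {t : ℝ} {s : Set ℝ}
    {r b : ℕ → ℝ≥0∞} (hr0 : ∀ n, 0 < r n) (hr : Tendsto r atTop (𝓝 0))
    (hb : Tendsto b atTop (𝓝 0)) (h : ∀ n, hausdorffPre t (r n) s ≤ b n) :
    μH[t] s = 0 := by
  have h1 : μH[t] s = OuterMeasure.mkMetric' (fun s : Set ℝ => Metric.ediam s ^ t) s := by
    rw [Measure.hausdorffMeasure, ← OuterMeasure.coe_mkMetric, OuterMeasure.mkMetric]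
  rw [h1]
  have h2 := (OuterMeasure.mkMetric'.tendsto_pre (fun s : Set ℝ => Metric.ediam s ^ t) s).comp
    (tendsto_nhdsWithin_iff.2 ⟨hr, Eventually.of_forall hr0⟩)
  exact le_antisymm (le_of_tendsto_of_tendsto' h2 hb h) zero_le

lemma XF_disjoint {l : ℝ} (h0 : 0 < l) (h1 : l < 1) {x : ℝ} {m n : ℕ}
    (hm : x ∈ XF l m) (hn : x ∈ XF l n) : m = n := by
  have h2 : n < m + 1 :=
    (pow_lt_pow_iff_right_of_lt_one₀ h0 h1).1 (hm.1.trans hn.2)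
  have h3 : m < n + 1 :=
    (pow_lt_pow_iff_right_of_lt_one₀ h0 h1).1 (hn.1.trans hm.2)
  omega

lemma Fmap_of_mem_XF_zero {l x : ℝ} (hx : x ∈ XF l 0) : Fmap l x = (x - l) / (1 - l) := by
  have : x ∈ Ioo l 1 := by simpa [XF] using hx
  rw [Fmap, if_pos this]

lemma Fmap_of_mem_XF_succ {l x : ℝ} (h0 : 0 < l) (h1 : l < 1) {k : ℕ}
    (hx : x ∈ XF l (k + 1)) : Fmap l x = (x - l ^ (k + 2)) / (l * (1 - l)) := by
  classical
  have hn : x ∉ Ioo l 1 := fun h => by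
    have : x ∈ XF l 0 := by simpa [XF] using h
    have := XF_disjoint h0 h1 this hx
    omega
  have he : ∃ n : ℕ, x ∈ Ioo (l ^ (n + 2)) (l ^ (n + 1)) := ⟨k, hx⟩
  rw [Fmap, if_neg hn, dif_pos he]
  have hf := Nat.find_spec he
  have : Nat.find he + 1 = k + 1 := XF_disjoint h0 h1 (m := Nat.find he + 1) hf hx
  have h3 : Nat.find he = k := by omega
  congr! 4

lemma Fmap_mem_Ioo {l x : ℝ} (h0 : 0 < l) (h1 : l < 1) {k : ℕ} (hx : x ∈ XF l k) :
    Fmap l x ∈ Ioo 0 (l ^ (k - 1)) := by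
  have h2 : 0 < 1 - l := by linarith
  cases k with
  | zero =>
    rw [Fmap_of_mem_XF_zero hx]
    have hx' : x ∈ Ioo l 1 := by simpa [XF] using hx
    refine ⟨div_pos (by linarith [hx'.1]) h2, ?_⟩
    simp only [zero_tsub, pow_zero]
    rw [div_lt_one h2]
    linarith [hx'.2]
  | succ k =>
    rw [Fmap_of_mem_XF_succ h0 h1 hx]
    have h3 := hx.1
    have h4 := hx.2
    refine ⟨div_pos (by linarith) (by positivity), ?_⟩
    rw [div_lt_iff₀ (by positivity), Nat.add_sub_cancel]
    calc _ < l ^ (k + 1) - l ^ (k + 2) := by linarith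
      _ = _ := by ring

lemma XF_subset_Ioo {l : ℝ} (h0 : 0 < l) (h1 : l < 1) (k : ℕ) : XF l k ⊆ Ioo 0 1 :=
  fun _ hx => ⟨(pow_pos h0 _).trans hx.1, hx.2.trans_le (pow_le_one₀ h0.le h1.le)⟩

lemma Fmap_mem_Frepeller {l x : ℝ} (hx : x ∈ Frepeller l) : Fmap l x ∈ Frepeller l :=
  fun n => by simpa [Function.iterate_succ_apply] using hx (n + 1)

/-- Points of the repeller that start in the `k`-th interval and are in the `m`-th one at
time `n`. -/
def Fvisit (l : ℝ) (m n k : ℕ) : Set ℝ :=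
  {x ∈ Frepeller l | x ∈ XF l k ∧ (Fmap l)^[n] x ∈ XF l m}

lemma Fmap_mem_Fvisit {l x : ℝ} (h0 : 0 < l) (h1 : l < 1) {m n k : ℕ}
    (hx : x ∈ Fvisit l m (n + 1) k) : ∃ i, Fmap l x ∈ Fvisit l m n (k - 1 + i) := by
  obtain ⟨hr, hk, hm⟩ := hx
  obtain ⟨j, hj⟩ := mem_iUnion.1 (Fmap_mem_Frepeller hr 0)
  have hlt : k - 1 < j + 1 :=
    (pow_lt_pow_iff_right_of_lt_one₀ h0 h1).1 (hj.1.trans (Fmap_mem_Ioo h0 h1 hk).2)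
  refine ⟨j - (k - 1), Fmap_mem_Frepeller hr, ?_, by simpa using hm⟩
  rw [Nat.add_sub_cancel' (by omega)]
  exact hj

lemma lipschitzWith_affine {c : ℝ} (hc : 0 ≤ c) (d : ℝ) :
    LipschitzWith c.toNNReal (fun y : ℝ => d + c * y) := by
  refine LipschitzWith.of_dist_le_mul fun x y => ?_
  rw [Real.dist_eq, Real.dist_eq, Real.coe_toNNReal _ hc, ← abs_of_nonneg hc, ← abs_mul,
    abs_of_nonneg hc]
  apply le_of_eq
  congr 1
  ring

lemma exists_Fmap_inverse_branch {l : ℝ} (h0 : 0 < l) (h1 : l < 1) (k : ℕ) :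
    ∃ d : ℝ, ∀ x ∈ XF l k, x = d + (if k = 0 then 1 - l else l * (1 - l)) * Fmap l x := by
  have h2 : 1 - l ≠ 0 := by linarith
  cases k with
  | zero =>
    refine ⟨l, fun x hx => ?_⟩
    rw [Fmap_of_mem_XF_zero hx, if_pos rfl]
    field_simp
    ring
  | succ k =>
    refine ⟨l ^ (k + 2), fun x hx => ?_⟩
    rw [Fmap_of_mem_XF_succ h0 h1 hx, if_neg (by omega)]
    field_simp
    ring

/-- The weights `2⁻ᵏ` on the intervals are contracted by the transfer operator, so the
pre-measures of the visiting sets decay geometrically in time. -/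
lemma hausdorffPre_Fvisit_le {l t : ℝ} (h0 : 0 < l) (h1 : l < 1) (ht : 0 < t) {ρ : ℝ≥0∞}
    (hv : 2 * ENNReal.ofReal (1 - l) ^ t ≤ ρ)
    (hw : 4 * ENNReal.ofReal (l * (1 - l)) ^ t ≤ ρ) (m n k : ℕ) :
    hausdorffPre t (ENNReal.ofReal (1 - l) ^ n) (Fvisit l m n k)
      ≤ ρ ^ n * (2⁻¹ ^ k * 2 ^ m) := by
  induction n generalizing k with
  | zero =>
    by_cases hkm : k = m
    · subst hkm
      have hd : Metric.ediam (Fvisit l k 0 k) ≤ 1 := by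
        refine (Metric.ediam_mono (fun x hx => XF_subset_Ioo h0 h1 k hx.2.1)).trans ?_
        simp [Real.ediam_Ioo]
      rw [pow_zero, pow_zero, one_mul, ← mul_pow, ENNReal.inv_mul_cancel (by simp) (by simp),
        one_pow]
      refine (OuterMeasure.mkMetric'.pre_le hd).trans ?_
      exact ENNReal.rpow_le_one hd ht.le
    · have : Fvisit l m 0 k = ∅ := by
        refine eq_empty_of_forall_notMem fun x hx => hkm (XF_disjoint h0 h1 hx.2.1 hx.2.2)
      rw [this]
      simp
  | succ n ih =>
    obtain ⟨d, hd⟩ := exists_Fmap_inverse_branch h0 h1 k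
    set c : ℝ := if k = 0 then 1 - l else l * (1 - l) with hc
    have h2 : 0 < 1 - l := by linarith
    have hc0 : 0 < c := by
      rw [hc]; split_ifs <;> positivity
    have hc1 : c ≤ 1 - l := by
      rw [hc]; split_ifs
      · exact le_rfl
      · nlinarith
    have hsub : Fvisit l m (n + 1) k ⊆
        (fun y : ℝ => d + c * y) '' ⋃ i, Fvisit l m n (k - 1 + i) := fun x hx =>
      ⟨Fmap l x, mem_iUnion.2 (Fmap_mem_Fvisit h0 h1 hx), (hd x hx.2.1).symm⟩
    have hrad : (c.toNNReal : ℝ≥0∞) * ENNReal.ofReal (1 - l) ^ n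
        ≤ ENNReal.ofReal (1 - l) ^ (n + 1) := by
      rw [pow_succ']
      exact mul_le_mul_left (ENNReal.ofReal_le_ofReal hc1) _
    have hsum : ∑' i : ℕ, (2⁻¹ : ℝ≥0∞) ^ (k - 1 + i) = 2⁻¹ ^ (k - 1) * 2 := by
      simp_rw [pow_add]
      rw [ENNReal.tsum_mul_left, ENNReal.tsum_geometric, ENNReal.one_sub_inv_two, inv_inv]
    have hfac : ENNReal.ofReal c ^ t * (2⁻¹ ^ (k - 1) * 2) ≤ ρ * 2⁻¹ ^ k := by
      cases k with
      | zero =>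
        simp only [hc, if_true, zero_tsub, pow_zero, one_mul, mul_one]
        rwa [mul_comm]
      | succ k =>
        have : (2 : ℝ≥0∞) = 4 * 2⁻¹ := by
          rw [show (4 : ℝ≥0∞) = 2 * 2 by norm_num, mul_assoc,
            ENNReal.mul_inv_cancel (by simp) (by simp), mul_one]
        rw [hc, if_neg (by omega), Nat.add_sub_cancel]
        calc _ = 4 * ENNReal.ofReal (l * (1 - l)) ^ t * (2⁻¹ ^ k * 2⁻¹) := by
              nth_rw 2 [this]; ring
          _ ≤ _ := by rw [pow_succ]; gcongr
    calc _ ≤ _ := (hausdorffPre t _).mono hsub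
      _ ≤ ENNReal.ofReal c ^ t * hausdorffPre t (ENNReal.ofReal (1 - l) ^ n)
            (⋃ i, Fvisit l m n (k - 1 + i)) :=
          hausdorffPre_image_le ht.le (by simpa using hc0) (lipschitzWith_affine hc0.le d)
            hrad _
      _ ≤ ENNReal.ofReal c ^ t * ∑' i, ρ ^ n * (2⁻¹ ^ (k - 1 + i) * 2 ^ m) := by
          gcongr
          exact (measure_iUnion_le _).trans (ENNReal.tsum_le_tsum fun i => ih _)
      _ = ρ ^ n * 2 ^ m * (ENNReal.ofReal c ^ t * (2⁻¹ ^ (k - 1) * 2)) := by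
          rw [ENNReal.tsum_mul_left, ENNReal.tsum_mul_right, hsum]
          ring
      _ ≤ ρ ^ n * 2 ^ m * (ρ * 2⁻¹ ^ k) := by gcongr
      _ = _ := by ring

lemma hausdorffMeasure_FrecSet {l t : ℝ} (h0 : 0 < l) (h1 : l < 1) (ht : 0 < t)
    (hv : 2 * ENNReal.ofReal (1 - l) ^ t < 1)
    (hw : 4 * ENNReal.ofReal (l * (1 - l)) ^ t < 1) :
    μH[t] (FrecSet l) = 0 := by
  obtain ⟨ρ, hρ, hρ1⟩ := exists_between (max_lt hv hw)
  have hsub : FrecSet l ⊆ ⋃ m, ⋃ k, {x | ∀ N, ∃ n ≥ N, x ∈ Fvisit l m n k} := by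
    rintro x ⟨hx, m, hm⟩
    obtain ⟨k, hk⟩ := mem_iUnion.1 (hx 0)
    refine mem_iUnion.2 ⟨m, mem_iUnion.2 ⟨k, fun N => ?_⟩⟩
    obtain ⟨n, hn, h⟩ := hm N
    exact ⟨n, hn, hx, hk, h⟩
  refine measure_mono_null hsub (measure_iUnion_null fun m => measure_iUnion_null fun k => ?_)
  have h2 : 0 < 1 - l := by linarith
  have hC : (2⁻¹ : ℝ≥0∞) ^ k * 2 ^ m ≠ ∞ :=
    ENNReal.mul_ne_top (ENNReal.pow_ne_top (by simp)) (ENNReal.pow_ne_top (by simp))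
  have hsm : ∑' n, ρ ^ n * (2⁻¹ ^ k * 2 ^ m : ℝ≥0∞) ≠ ∞ := by
    rw [ENNReal.tsum_mul_right, ENNReal.tsum_geometric]
    refine ENNReal.mul_ne_top ?_ hC
    rw [ENNReal.inv_ne_top]
    exact (tsub_pos_of_lt hρ1).ne'
  refine hausdorffMeasure_eq_zero_of_hausdorffPre (r := fun N => ENNReal.ofReal (1 - l) ^ N)
    (b := fun N => ∑' n, ρ ^ (n + N) * (2⁻¹ ^ k * 2 ^ m : ℝ≥0∞)) (fun N => ?_) ?_ ?_ fun N => ?_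
  · exact pos_iff_ne_zero.2 (pow_ne_zero _ (by simpa using h1))
  · refine ENNReal.tendsto_pow_atTop_nhds_zero_of_lt_one ?_
    rw [ENNReal.ofReal_lt_one]
    linarith
  · exact ENNReal.tendsto_sum_nat_add (fun n => ρ ^ n * (2⁻¹ ^ k * 2 ^ m : ℝ≥0∞)) hsm
  · have hs : {x | ∀ N, ∃ n ≥ N, x ∈ Fvisit l m n k} ⊆ ⋃ n, Fvisit l m (n + N) k := by
      intro x hx
      obtain ⟨n, hn, h⟩ := hx N
      refine mem_iUnion.2 ⟨n - N, ?_⟩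
      rwa [Nat.sub_add_cancel hn]
    refine (measure_mono hs).trans ((measure_iUnion_le _).trans
      (ENNReal.tsum_le_tsum fun n => ?_))
    refine (hausdorffPre_anti t ?_ _).trans (hausdorffPre_Fvisit_le h0 h1 ht
      ((le_max_left _ _).trans hρ.le) ((le_max_right _ _).trans hρ.le) m (n + N) k)
    exact pow_le_pow_right_of_le_one' (by rw [ENNReal.ofReal_le_one]; linarith) (by omega)

lemma log_four_div_lt_one {l : ℝ} (hl : l ∈ Ioo (1 / 2 : ℝ) 1) :
    -Real.log 4 / Real.log (l * (1 - l)) < 1 := by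
  obtain ⟨h0, h1⟩ := hl
  have hp : 0 < l * (1 - l) := mul_pos (by linarith) (by linarith)
  have hlt : l * (1 - l) < 4⁻¹ := by nlinarith [sq_pos_of_pos (sub_pos.2 h0)]
  have h2 : Real.log (l * (1 - l)) < -Real.log 4 := by
    rw [← Real.log_inv]
    exact Real.log_lt_log hp hlt
  have h3 : 0 < Real.log 4 := Real.log_pos (by norm_num)
  rw [div_lt_one_of_neg (by linarith)]
  exact h2

lemma dimH_FrecSet_le {l : ℝ} (hl : l ∈ Ioo (1 / 2 : ℝ) 1) :
    dimH (FrecSet l) ≤ ENNReal.ofReal (-Real.log 4 / Real.log (l * (1 - l))) := by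
  obtain ⟨h0, h1⟩ := hl
  have hp : 0 < l * (1 - l) := mul_pos (by linarith) (by linarith)
  have hlt : l * (1 - l) < 4⁻¹ := by nlinarith [sq_pos_of_pos (sub_pos.2 h0)]
  have hlog : Real.log (l * (1 - l)) < 0 := Real.log_neg hp (by linarith)
  have h4 : 0 < Real.log 4 := Real.log_pos (by norm_num)
  have hs0 : 0 ≤ -Real.log 4 / Real.log (l * (1 - l)) :=
    div_nonneg_of_nonpos (by linarith) hlog.le
  refine dimH_le fun t hinf => ?_
  by_contra! hcon
  rw [ENNReal.ofReal_lt_coe_iff hs0] at hcon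
  have ht0 : (0 : ℝ) < t := hs0.trans_lt hcon
  have hw : (l * (1 - l)) ^ (t : ℝ) < 4⁻¹ := by
    rw [Real.rpow_def_of_pos hp, ← Real.lt_log_iff_exp_lt (by norm_num), Real.log_inv]
    rw [div_lt_iff_of_neg hlog] at hcon
    linarith
  have hq : 0 < 1 - l := by linarith
  have hv : (1 - l) ^ (t : ℝ) < 2⁻¹ := by
    have h5 : (1 - l) ^ (t : ℝ) * (1 - l) ^ (t : ℝ) ≤ (l * (1 - l)) ^ (t : ℝ) := by
      rw [← Real.mul_rpow hq.le hq.le]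
      exact Real.rpow_le_rpow (by positivity) (by nlinarith) ht0.le
    nlinarith [Real.rpow_nonneg hq.le (t : ℝ)]
  have hz := hausdorffMeasure_FrecSet (by linarith) h1 ht0
    (l := l) (t := t) (by
      rw [ENNReal.ofReal_rpow_of_pos hq, ← ENNReal.ofReal_ofNat 2,
        ← ENNReal.ofReal_mul (by norm_num), ENNReal.ofReal_lt_one]
      linarith) (by
      rw [ENNReal.ofReal_rpow_of_pos hp, ← ENNReal.ofReal_ofNat 4,
        ← ENNReal.ofReal_mul (by norm_num), ENNReal.ofReal_lt_one]
      linarith)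
  rw [hz] at hinf
  exact ENNReal.zero_ne_top hinf

lemma tendsto_iterate_zero_of_notMem_FrecSet {l x : ℝ} (h0 : 0 < l) (h1 : l < 1)
    (hx : x ∈ Frepeller l) (hn : x ∉ FrecSet l) :
    Tendsto (fun n => (Fmap l)^[n] x) atTop (𝓝 0) := by
  have hfin : ∀ m, ∀ᶠ n in atTop, (Fmap l)^[n] x ∉ XF l m := by
    intro m
    by_contra hcon
    refine hn ⟨hx, m, fun N => ?_⟩
    have := (frequently_atTop.1 (not_eventually.1 hcon)) N
    simpa using this
  refine tendsto_order.2 ⟨fun b hb => Eventually.of_forall fun n => ?_, fun b hb => ?_⟩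
  · obtain ⟨k, hk⟩ := mem_iUnion.1 (hx n)
    exact hb.trans (XF_subset_Ioo h0 h1 k hk).1
  · obtain ⟨M, hM⟩ := exists_pow_lt_of_lt_one hb h1
    filter_upwards [(eventually_all_finset (Finset.range M)).2 fun m _ => hfin m] with n h
    obtain ⟨k, hk⟩ := mem_iUnion.1 (hx n)
    have hMk : M ≤ k := by
      by_contra! hlt
      exact h k (Finset.mem_range.2 hlt) hk
    exact hk.2.trans ((pow_le_pow_of_le_one h0.le h1.le hMk).trans_lt hM)

lemma tendsto_birk_of_notMem_FrecSet {l x a : ℝ} {φ : ℝ → ℝ} (h0 : 0 < l) (h1 : l < 1)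
    (ha : Tendsto φ (𝓝[Ioc 0 1] 0) (𝓝 a)) (hx : x ∈ Frepeller l) (hn : x ∉ FrecSet l) :
    Tendsto (fun n => birk (Fmap l) φ n x / n) atTop (𝓝 a) := by
  have h2 : Tendsto (fun n => (Fmap l)^[n] x) atTop (𝓝[Ioc 0 1] 0) := by
    refine tendsto_nhdsWithin_iff.2 ⟨tendsto_iterate_zero_of_notMem_FrecSet h0 h1 hx hn,
      Eventually.of_forall fun n => ?_⟩
    obtain ⟨k, hk⟩ := mem_iUnion.1 (hx n)
    exact Ioo_subset_Ioc_self (XF_subset_Ioo h0 h1 k hk)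
  refine (ha.comp h2).cesaro.congr fun n => ?_
  simp [birk, div_eq_inv_mul]

lemma countable_Ioo_diff_FdomainSet {l : ℝ} (h0 : 0 < l) (h1 : l < 1) :
    (Ioo 0 1 \ FdomainSet l).Countable := by
  refine (countable_range fun n : ℕ => l ^ n).mono fun x hx => ?_
  obtain ⟨n, hn, hn'⟩ := exists_nat_pow_near_of_lt_one hx.1.1 hx.1.2.le h0 h1
  rcases hn'.lt_or_eq with h | h
  · exact absurd (mem_iUnion.2 ⟨n, (⟨hn, h⟩ : x ∈ XF l n)⟩) hx.2
  · exact ⟨n, h.symm⟩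

lemma countable_Ioo_diff_Frepeller {l : ℝ} (h0 : 0 < l) (h1 : l < 1) :
    (Ioo 0 1 \ Frepeller l).Countable := by
  have key : ∀ n, {x ∈ Ioo (0 : ℝ) 1 | (Fmap l)^[n] x ∉ FdomainSet l}.Countable := by
    intro n
    induction n with
    | zero => exact countable_Ioo_diff_FdomainSet h0 h1
    | succ n ih =>
      choose d hd using exists_Fmap_inverse_branch h0 h1
      have hpre : (⋃ k : ℕ, (fun y => d k + (if k = 0 then 1 - l else l * (1 - l)) * y) ''
          {x ∈ Ioo (0 : ℝ) 1 | (Fmap l)^[n] x ∉ FdomainSet l}).Countable :=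
        countable_iUnion fun k => ih.image _
      refine ((countable_Ioo_diff_FdomainSet h0 h1).union hpre).mono ?_
      rintro x ⟨hx, hxn⟩
      by_cases hdom : x ∈ FdomainSet l
      · obtain ⟨k, hk⟩ := mem_iUnion.1 hdom
        have hF := Fmap_mem_Ioo h0 h1 hk
        refine Or.inr (mem_iUnion.2 ⟨k, ?_⟩)
        exact ⟨Fmap l x, ⟨⟨hF.1, hF.2.trans_le (pow_le_one₀ h0.le h1.le)⟩, by simpa using hxn⟩,
          (hd k x hk).symm⟩
      · exact Or.inl ⟨hx, hdom⟩
  refine (countable_iUnion key).mono fun x hx => ?_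
  obtain ⟨n, hn⟩ := not_forall.1 hx.2
  exact mem_iUnion.2 ⟨n, hx.1, hn⟩

/-- **Theorem.** For `λ ∈ (1/2, 1)` and a Hölder potential `φ : (0,1] → ℝ` with
`lim_{x→0} φ(x) = a`: for every `α ≠ a`,
`dim_H J_{φ,1}(α) ≤ -log 4 / log(λ(1-λ)) < 1`. In particular, since
`dim_H J_{φ,1}(a) = 1`, the Birkhoff spectrum `α ↦ dim_H J_{φ,1}(α)` is
discontinuous at `α = a`. -/
theorem F_birkhoff_spectrum_discontinuous
    (l : ℝ) (hl : l ∈ Set.Ioo (1 / 2 : ℝ) 1)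
    (φ : ℝ → ℝ) (hφ : HolderPotential φ)
    (a : ℝ) (ha : Filter.Tendsto φ (nhdsWithin 0 (Set.Ioc (0 : ℝ) 1)) (nhds a)) :
    (∀ α : ℝ, α ≠ a →
      dimH (FJB l φ α) ≤ ENNReal.ofReal (-Real.log 4 / Real.log (l * (1 - l)))) ∧
    ENNReal.ofReal (-Real.log 4 / Real.log (l * (1 - l))) < 1 ∧
    dimH (FJB l φ a) = 1 ∧
    ¬ ContinuousAt (fun α : ℝ => dimH (FJB l φ α)) a := by
  have h0 : 0 < l := by linarith [hl.1]
  have h1 : l < 1 := hl.2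
  have hs : ENNReal.ofReal (-Real.log 4 / Real.log (l * (1 - l))) < 1 :=
    ENNReal.ofReal_lt_one.2 (log_four_div_lt_one hl)
  have hrec := dimH_FrecSet_le hl
  have hup : ∀ α : ℝ, α ≠ a →
      dimH (FJB l φ α) ≤ ENNReal.ofReal (-Real.log 4 / Real.log (l * (1 - l))) := by
    intro α hα
    refine (dimH_mono fun x hx => ?_).trans hrec
    by_contra hn
    exact hα (tendsto_nhds_unique hx.2 (tendsto_birk_of_notMem_FrecSet h0 h1 ha hx.1 hn))
  have hone : dimH (FJB l φ a) = 1 := by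
    refine le_antisymm ((dimH_mono (subset_univ _)).trans_eq Real.dimH_univ) ?_
    have hI : dimH (Ioo (0 : ℝ) 1) = 1 := by
      rw [Real.dimH_of_nonempty_interior (by simp)]
      simp
    have hsub : Ioo (0 : ℝ) 1 ⊆ FJB l φ a ∪ ((Ioo 0 1 \ Frepeller l) ∪ FrecSet l) := by
      intro x hx
      by_cases hr : x ∈ Frepeller l
      · by_cases hn : x ∈ FrecSet l
        · exact Or.inr (Or.inr hn)
        · exact Or.inl ⟨hr, tendsto_birk_of_notMem_FrecSet h0 h1 ha hr hn⟩
      · exact Or.inr (Or.inl ⟨hx, hr⟩)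
    have hle := dimH_mono hsub
    rw [hI, dimH_union, dimH_union, dimH_countable (countable_Ioo_diff_Frepeller h0 h1)] at hle
    rcases le_max_iff.1 hle with h | h
    · exact h
    · rw [max_eq_right zero_le] at h
      exact absurd (h.trans hrec) hs.not_ge
  refine ⟨hup, hs, hone, fun hc => ?_⟩
  have hle : dimH (FJB l φ a) ≤ _ :=
    le_of_tendsto (hc.tendsto.mono_left (nhdsWithin_le_nhds (s := {a}ᶜ)))
      (eventually_nhdsWithin_of_forall hup)
  rw [hone] at hle
  exact hs.not_ge hle

end
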